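/- arXiv:math/0405092 — 2 statements merged into one kernel-verified Lean document; each statement's English description precedes it below -/
import Mathlib

section
/- Suppose 𝒳 ⊆ C_∞ and B : 𝒳 → 𝒫(Q) is any function. Then for every integer j the set {z ∈ 2^ℕ : ρ(⟨z,B⟩) < j} is an analytic subset of 2^ℕ. -/
open MeasureTheory Filter Set Topology
open scoped ENNReal

noncomputable section

/-- The Cantor space `2^ℕ`. -/
abbrev Cantor : Type := ℕ → Bool

/-- The uniform product ("fair coin-flipping") probability measure on `2^ℕ`, realized as the
pushforward of Lebesgue measure on `[0,1)` under the binary-digit map. -/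
noncomputable def cantorMeasure : Measure Cantor :=
  Measure.map (fun x : ℝ => fun n : ℕ => decide (⌊x * 2 ^ (n + 1)⌋ % 2 = 1))
    (volume.restrict (Set.Ico (0 : ℝ) 1))

/-- The basic cylinder `[a]` determined by a finite binary sequence `a`. -/
def cyl (a : List Bool) : Set Cantor := {x | ∀ i : Fin a.length, x i = a.get i}

/-- `[A] = ⋃ a ∈ A, [a]`. -/
def cylSet (A : Set (List Bool)) : Set Cantor := ⋃ a ∈ A, cyl a

/-- The weight `2^(-|a|·r)` of a node `a`. -/
noncomputable def wt (r : ℝ) (a : List Bool) : ℝ≥0∞ := (2 : ℝ≥0∞) ^ (-(a.length : ℝ) * r)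

/-- `Σ_{a ∈ A} 2^(-|a|·r)`. -/
noncomputable def wtSum (r : ℝ) (A : Set (List Bool)) : ℝ≥0∞ := ∑' a : A, wt r (a : List Bool)

/-- `A ∈ C^∞_ε`, i.e. `Σ_{a ∈ A} 2^(-|a|·r) ≤ ε`. -/
def memCinf (r ε : ℝ) (A : Set (List Bool)) : Prop := wtSum r A ≤ ENNReal.ofReal ε

/-- The `r`-dimensional dyadic Hausdorff capacity `λ^r_∞`. -/
noncomputable def hcap (r : ℝ) (X : Set Cantor) : ℝ≥0∞ :=
  ⨅ (A : Set (List Bool)) (_ : X ⊆ cylSet A), wtSum r A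

/-- `□_δ(X) = inf {λ^r_∞(X \ Z) : Z measurable, λ Z < δ}`. -/
noncomputable def sqcap (r δ : ℝ) (X : Set Cantor) : ℝ≥0∞ :=
  ⨅ (Z : Set Cantor) (_ : MeasurableSet Z) (_ : cantorMeasure Z < ENNReal.ofReal δ),
    hcap r (X \ Z)

/-- The relation `□_{Θ,Γ}(X)` for `X ⊆ (2^ℕ)^(d+1)` (the index `d` codes dimension `d+1`):
for dimension `1` it says `□_{Θ 0}(X) ≥ Γ 0`, and for dimension `n+2` it says
`□_{Θ (n+1)}({x : □_{Θ,Γ}(X(x,·))}) ≥ Γ (n+1)`, slicing along the first coordinate. -/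
def SqTG (r : ℝ) (Θ Γ : ℕ → ℝ) : (d : ℕ) → Set (Fin (d + 1) → Cantor) → Prop
  | 0, X => ENNReal.ofReal (Γ 0) ≤ sqcap r (Θ 0) {y : Cantor | (fun _ : Fin 1 => y) ∈ X}
  | (n + 1), X => ENNReal.ofReal (Γ (n + 1)) ≤
      sqcap r (Θ (n + 1))
        {x : Cantor | SqTG r Θ Γ n {y : Fin (n + 1) → Cantor | Fin.cons x y ∈ X}}

/-- `□_{Θ,Γ}` reindexed by the true dimension `d ≥ 1`. -/
def SqDim (r : ℝ) (Θ Γ : ℕ → ℝ) : (d : ℕ) → Set (Fin d → Cantor) → Prop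
  | 0, _ => False
  | (n + 1), X => SqTG r Θ Γ n X

/-- `□_*(X)` : `□_{η,Γ}(X)` holds for some `η : ℕ → ℝ⁺`. -/
def SqStarDim (r : ℝ) (Γ : ℕ → ℝ) (d : ℕ) (X : Set (Fin d → Cantor)) : Prop :=
  ∃ η : ℕ → ℝ, (∀ i, 0 < η i) ∧ SqDim r η Γ d X

/-- `⟨z,F⟩ = {w ∈ 𝒳 : z ∉ [F w]}`. -/
def angbr (z : Cantor) (F : Set (List Bool) → Set (List Bool))
    (𝒳 : Set (Set (List Bool))) : Set (Set (List Bool)) := {w ∈ 𝒳 | z ∉ cylSet (F w)}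

/-- `ρ*(𝒳)`: the set of `d > 1` such that for every compact `C ⊆ (2^ℕ)^d` with `□(C)` and every
continuous `F : C → 2^ℕ` there is `x ∈ 𝒳` with `□_*(F⁻¹[x])`. -/
def rhoStar (r : ℝ) (Θ Γ : ℕ → ℝ) (𝒳 : Set (Set (List Bool))) : Set ℕ :=
  {d : ℕ | 1 < d ∧ ∀ C : Set (Fin d → Cantor), IsCompact C → SqDim r Θ Γ d C →
    ∀ F : (Fin d → Cantor) → Cantor, ContinuousOn F C →
      ∃ x ∈ 𝒳, SqStarDim r Γ d (C ∩ F ⁻¹' cylSet x)}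

/-- `ρ(𝒳) = sup ρ*(𝒳)` (with `sup ∅ = 0`). -/
noncomputable def rho (r : ℝ) (Θ Γ : ℕ → ℝ) (𝒳 : Set (Set (List Bool))) : ℕ∞ :=
  sSup ((fun d : ℕ => (d : ℕ∞)) '' rhoStar r Θ Γ 𝒳)

/-- Closed subsets of `E` are coded by the sets of basic open sets disjoint from them. -/
def codedClosed {E : Type} [TopologicalSpace E] [SecondCountableTopology E]
    (k : TopologicalSpace.countableBasis E → Bool) : Set E :=
  {x | ∀ U : TopologicalSpace.countableBasis E, k U = true → x ∉ (U : Set E)}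

section Coding

variable {E : Type} [TopologicalSpace E] [SecondCountableTopology E]

lemma exists_codedClosed_eq {C : Set E} (hC : IsClosed C) :
    ∃ k : TopologicalSpace.countableBasis E → Bool, codedClosed k = C := by
  classical
  refine ⟨fun U => decide (Disjoint (U : Set E) C), ?_⟩
  ext x
  constructor
  · intro hx
    by_contra hxC
    obtain ⟨U, hU, hxU, hUC⟩ :=
      (TopologicalSpace.isBasis_countableBasis E).exists_subset_of_mem_open
        (show x ∈ Cᶜ from hxC) hC.isOpen_compl
    exact hx ⟨U, hU⟩ (decide_eq_true (disjoint_left.2 fun y hy => hUC hy)) hxU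
  · intro hx U hU hxU
    exact disjoint_left.1 (of_decide_eq_true hU) hxU hx

lemma isClosed_codedClosed_graph :
    IsClosed {p : (TopologicalSpace.countableBasis E → Bool) × E | p.2 ∈ codedClosed p.1} := by
  have hG : {p : (TopologicalSpace.countableBasis E → Bool) × E | p.2 ∈ codedClosed p.1} =
      ⋂ U : TopologicalSpace.countableBasis E, {p | p.1 U = false} ∪ {p | p.2 ∉ (U : Set E)} := by
    ext p
    simp [codedClosed, or_iff_not_imp_left]
  rw [hG]
  refine isClosed_iInter fun U => IsClosed.union ?_ ?_
  · have h : Continuous fun p : (TopologicalSpace.countableBasis E → Bool) × E => p.1 U :=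
      (continuous_apply U).comp continuous_fst
    exact (isClosed_discrete {false}).preimage h
  · exact (TopologicalSpace.isOpen_of_mem_countableBasis U.2).isClosed_compl.preimage
      continuous_snd

lemma isClosed_codedClosed (k : TopologicalSpace.countableBasis E → Bool) :
    IsClosed (codedClosed k) :=
  isClosed_codedClosed_graph.preimage (Continuous.prodMk_right k)

end Coding

/-- The projection of a closed set along a compact factor is closed. -/
lemma IsClosed.exists_mem {S K : Type*} [TopologicalSpace S] [TopologicalSpace K]
    [CompactSpace K] {G : Set (S × K)} (hG : IsClosed G) : IsClosed {s | ∃ x, (s, x) ∈ G} := by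
  convert isClosedMap_fst_of_compactSpace _ hG using 1
  ext s
  simp

/-- Fibres of a closed set with compact vertical factor depend upper semicontinuously on the
base point. -/
lemma isOpen_setOf_fiber_subset {S K : Type*} [TopologicalSpace S] [TopologicalSpace K]
    [CompactSpace K] {G : Set (S × K)} (hG : IsClosed G) {U : Set K} (hU : IsOpen U) :
    IsOpen {s | {x | (s, x) ∈ G} ⊆ U} := by
  rw [← isClosed_compl_iff]
  convert (hG.inter (hU.isClosed_compl.preimage continuous_snd)).exists_mem using 1
  ext s
  simp [not_subset]

lemma hcap_mono (r : ℝ) {X Y : Set Cantor} (h : X ⊆ Y) : hcap r X ≤ hcap r Y :=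
  le_iInf₂ fun A hA => iInf₂_le A (h.trans hA)

lemma sqcap_mono (r : ℝ) {δ δ' : ℝ} (hδ : δ' ≤ δ) {X Y : Set Cantor} (h : X ⊆ Y) :
    sqcap r δ X ≤ sqcap r δ' Y :=
  le_iInf fun Z => le_iInf₂ fun hZ hZδ =>
    (iInf_le _ Z).trans <| (iInf₂_le hZ (hZδ.trans_le (ENNReal.ofReal_le_ofReal hδ))).trans
      (hcap_mono r (sdiff_subset_sdiff_left h))

lemma isClopen_cyl (a : List Bool) : IsClopen (cyl a) := by
  simp only [cyl, ofPred_forall]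
  exact isClopen_iInter_of_finite fun i =>
    (isClopen_discrete {a.get i}).preimage (continuous_apply (i : ℕ))

lemma isOpen_cylSet (A : Set (List Bool)) : IsOpen (cylSet A) :=
  isOpen_biUnion fun a _ => (isClopen_cyl a).isOpen

lemma isClosed_cylSet {A : Set (List Bool)} (hA : A.Finite) : IsClosed (cylSet A) :=
  hA.isClosed_biUnion fun a _ => (isClopen_cyl a).isClosed

instance : IsFiniteMeasure cantorMeasure := by
  unfold cantorMeasure
  infer_instance

lemma exists_isOpen_sqcap_lt {r δ : ℝ} {X : Set Cantor} {g : ℝ≥0∞} (h : sqcap r δ X < g) :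
    ∃ U, IsOpen U ∧ X ⊆ U ∧ sqcap r δ U < g := by
  simp only [sqcap, hcap, iInf_lt_iff] at h
  obtain ⟨Z, -, hZδ, A, hXA, hAg⟩ := h
  obtain ⟨O, hZO, hO, hOδ⟩ := Z.exists_isOpen_lt_of_lt _ hZδ
  refine ⟨cylSet A ∪ O, (isOpen_cylSet A).union hO, fun x hx => ?_, lt_of_le_of_lt ?_ hAg⟩
  · by_cases hxZ : x ∈ Z
    · exact Or.inr (hZO hxZ)
    · exact Or.inl (hXA ⟨hx, hxZ⟩)
  · refine (iInf_le _ O).trans ((iInf₂_le hO.measurableSet hOδ).trans ?_)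
    exact iInf₂_le A (by rw [union_sdiff_right]; exact sdiff_subset)

lemma isClosed_setOf_le_sqcap {S : Type} [TopologicalSpace S] {G : Set (S × Cantor)}
    (hG : IsClosed G) (r δ : ℝ) (g : ℝ≥0∞) :
    IsClosed {s | g ≤ sqcap r δ {x | (s, x) ∈ G}} := by
  rw [← isOpen_compl_iff, isOpen_iff_mem_nhds]
  intro s hs
  obtain ⟨U, hU, hsU, hlt⟩ := exists_isOpen_sqcap_lt (not_le.1 hs)
  filter_upwards [(isOpen_setOf_fiber_subset hG hU).mem_nhds hsU] with t ht
  exact not_le.2 ((sqcap_mono r le_rfl ht).trans_lt hlt)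

/-- The relation `□_{Θ,Γ}` is closed along families of compact sets with closed graph. -/
lemma isClosed_setOf_sqTG (r : ℝ) (Θ Γ : ℕ → ℝ) (n : ℕ) {S : Type} [TopologicalSpace S]
    {G : Set (S × (Fin (n + 1) → Cantor))} (hG : IsClosed G) :
    IsClosed {s | SqTG r Θ Γ n {y | (s, y) ∈ G}} := by
  induction n generalizing S with
  | zero =>
    have h : IsClosed {p : S × Cantor | (p.1, fun _ : Fin 1 => p.2) ∈ G} :=
      hG.preimage (by fun_prop)
    exact isClosed_setOf_le_sqcap h r (Θ 0) _
  | succ n ih =>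
    have h : IsClosed {p : (S × Cantor) × (Fin (n + 1) → Cantor) |
        (p.1.1, (Fin.cons p.1.2 p.2 : Fin (n + 2) → Cantor)) ∈ G} :=
      hG.preimage (by fun_prop)
    exact isClosed_setOf_le_sqcap (ih h) r (Θ (n + 1)) _

lemma SqTG.mono (r : ℝ) (Γ : ℕ → ℝ) {Θ Θ' : ℕ → ℝ} (n : ℕ) (hΘ : ∀ i ≤ n, Θ' i ≤ Θ i)
    {X : Set (Fin (n + 1) → Cantor)} (h : SqTG r Θ Γ n X) : SqTG r Θ' Γ n X := by
  induction n with
  | zero => exact h.trans (sqcap_mono r (hΘ 0 le_rfl) subset_rfl)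
  | succ n ih =>
    exact h.trans (sqcap_mono r (hΘ _ le_rfl) fun x hx => ih (fun i hi => hΘ i (by omega)) hx)

lemma sqStarDim_iff_exists_nat (r : ℝ) (Γ : ℕ → ℝ) (n : ℕ) (X : Set (Fin (n + 1) → Cantor)) :
    SqStarDim r Γ (n + 1) X ↔ ∃ m : ℕ, SqTG r (fun _ => 1 / ((m : ℝ) + 1)) Γ n X := by
  constructor
  · rintro ⟨η, hη, h⟩
    have hev : ∀ᶠ m : ℕ in atTop, ∀ i ∈ Finset.range (n + 1), 1 / ((m : ℝ) + 1) ≤ η i := by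
      rw [Filter.eventually_all_finset]
      exact fun i _ =>
        (tendsto_one_div_add_atTop_nhds_zero_nat.eventually_lt_const (hη i)).mono
          fun m hm => hm.le
    obtain ⟨m, hm⟩ := hev.exists
    exact ⟨m, SqTG.mono r Γ n (fun i hi => hm i (Finset.mem_range.2 (by omega))) h⟩
  · rintro ⟨m, h⟩
    exact ⟨_, fun _ => by positivity, h⟩

lemma measurableSet_setOf_sqStarDim (r : ℝ) (Γ : ℕ → ℝ) (n : ℕ) {S : Type} [TopologicalSpace S]
    [MeasurableSpace S] [OpensMeasurableSpace S] {G : Set (S × (Fin (n + 1) → Cantor))}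
    (hG : IsClosed G) : MeasurableSet {s | SqStarDim r Γ (n + 1) {y | (s, y) ∈ G}} := by
  simp only [sqStarDim_iff_exists_nat, ofPred_exists]
  exact MeasurableSet.iUnion fun m => (isClosed_setOf_sqTG r _ Γ n hG).measurableSet

/-- A function whose graph over `C` is a compact set is continuous on `C`. -/
lemma continuousOn_of_isCompact_graph {X Y : Type*} [TopologicalSpace X] [T2Space X]
    [TopologicalSpace Y] {C : Set X} {f : X → Y}
    (h : IsCompact {p : X × Y | p.1 ∈ C ∧ p.2 = f p.1}) : ContinuousOn f C := by
  rw [continuousOn_iff_isClosed]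
  intro t ht
  refine ⟨_, ((h.inter_right (ht.preimage continuous_snd)).image continuous_fst).isClosed, ?_⟩
  ext x
  simp only [mem_inter_iff, mem_preimage, mem_image, mem_ofPred_eq, Prod.exists]
  grind

instance polishSpace_pi_bool (ι : Type*) [Countable ι] : PolishSpace (ι → Bool) :=
  { (inferInstance : SecondCountableTopology (ι → Bool)),
    (inferInstance : TopologicalSpace.IsCompletelyMetrizableSpace (ι → Bool)) with }

lemma rho_lt_iff (r : ℝ) (Θ Γ : ℕ → ℝ) (𝒲 : Set (Set (List Bool))) {j : ℕ} (hj : j ≠ 0) :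
    rho r Θ Γ 𝒲 < (j : ℕ∞) ↔ ∀ d, j ≤ d → d ∉ rhoStar r Θ Γ 𝒲 := by
  constructor
  · intro h d hd hmem
    have hle : (d : ℕ∞) ≤ rho r Θ Γ 𝒲 := le_sSup (mem_image_of_mem _ hmem)
    exact absurd (Nat.cast_lt.1 (hle.trans_lt h)) (by omega)
  · intro h
    have hle : rho r Θ Γ 𝒲 ≤ ((j - 1 : ℕ) : ℕ∞) := by
      refine sSup_le ?_
      rintro _ ⟨d, hd, rfl⟩
      have hdj : d < j := not_le.1 fun hle => h d hle hd
      exact Nat.cast_le.2 (by omega)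
    exact hle.trans_lt (Nat.cast_lt.2 (by omega))

/-- Failure of `n + 1 ∈ ρ*` is witnessed by the graph of a continuous function on a compact set,
that is, by a closed subset `K` of `(2^ℕ)^(n+1) × 2^ℕ` that is single-valued. -/
lemma notMem_rhoStar_iff (r : ℝ) (Θ Γ : ℕ → ℝ) (𝒲 : Set (Set (List Bool))) {n : ℕ} (hn : 0 < n) :
    n + 1 ∉ rhoStar r Θ Γ 𝒲 ↔
      ∃ K : Set ((Fin (n + 1) → Cantor) × Cantor), IsClosed K ∧
        SqTG r Θ Γ n {a | ∃ b, (a, b) ∈ K} ∧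
        (∀ a b b', (a, b) ∈ K → (a, b') ∈ K → b = b') ∧
        ∀ w ∈ 𝒲, ¬ SqStarDim r Γ (n + 1) {a | ∃ b, (a, b) ∈ K ∧ b ∈ cylSet w} := by
  constructor
  · intro h
    simp only [rhoStar, mem_ofPred_eq, not_and] at h
    specialize h (by omega)
    push Not at h
    obtain ⟨C, hC, hsq, F, hF, hw⟩ := h
    have himage : IsCompact ((fun a => (a, F a)) '' C) :=
      hC.image_of_continuousOn (continuousOn_id.prodMk hF)
    refine ⟨_, himage.isClosed, ?_, ?_, fun w hwm => ?_⟩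
    · convert hsq using 1
      simp [SqDim]
    · rintro a b b' ⟨_, -, h⟩ ⟨_, -, h'⟩
      grind
    · convert hw w hwm using 2
      ext a
      simp
  · rintro ⟨K, hK, hsq, hfun, hw⟩ h
    classical
    set C : Set (Fin (n + 1) → Cantor) := {a | ∃ b, (a, b) ∈ K}
    set F : (Fin (n + 1) → Cantor) → Cantor :=
      fun a => if ha : ∃ b, (a, b) ∈ K then ha.choose else default
    have hF : ∀ a b, (a, b) ∈ K ↔ a ∈ C ∧ b = F a := by
      intro a b
      by_cases ha : ∃ b, (a, b) ∈ K
      · have hFa : (a, F a) ∈ K := by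
          simp only [F, dif_pos ha]
          exact ha.choose_spec
        exact ⟨fun hab => ⟨ha, hfun a _ _ hab hFa⟩, fun hab => hab.2 ▸ hFa⟩
      · exact ⟨fun hab => absurd ⟨b, hab⟩ ha, fun hab => absurd hab.1 ha⟩
    have hgraph : {p : (Fin (n + 1) → Cantor) × Cantor | p.1 ∈ C ∧ p.2 = F p.1} = K := by
      ext ⟨a, b⟩
      exact (hF a b).symm
    have hC : IsCompact C := by
      have hC' : IsClosed C := hK.exists_mem
      exact hC'.isCompact
    obtain ⟨w, hwm, hstar⟩ :=
      h.2 C hC hsq F (continuousOn_of_isCompact_graph (hgraph ▸ hK.isCompact))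
    refine hw w hwm ?_
    convert hstar using 1
    ext a
    simp only [hF, mem_ofPred_eq, mem_inter_iff, mem_preimage]
    grind

lemma analyticSet_setOf_notMem_rhoStar (r : ℝ) (Θ Γ : ℕ → ℝ) {𝒳 : Set (Set (List Bool))}
    (h𝒳 : ∀ a ∈ 𝒳, a.Finite) (B : Set (List Bool) → Set (List Bool)) (d : ℕ) :
    AnalyticSet {z : Cantor | d ∉ rhoStar r Θ Γ (angbr z B 𝒳)} := by
  rcases le_or_gt d 1 with hd | hd
  · have huniv : {z : Cantor | d ∉ rhoStar r Θ Γ (angbr z B 𝒳)} = univ :=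
      eq_univ_of_forall fun z hz => absurd hz.1 (by omega)
    exact huniv ▸ isClosed_univ.analyticSet
  obtain ⟨n, rfl⟩ : ∃ n, d = n + 1 := ⟨d - 1, by omega⟩
  have hn : 0 < n := by omega
  have hcount : 𝒳.Countable :=
    (countable_ofPred_finite_subset (countable_univ (α := List Bool))).mono fun a ha =>
      show a.Finite ∧ a ⊆ univ from ⟨h𝒳 a ha, subset_univ a⟩
  let E := (Fin (n + 1) → Cantor) × Cantor
  let T := TopologicalSpace.countableBasis E → Bool
  let M₁ : Set T := {k | SqTG r Θ Γ n {a | ∃ b, (a, b) ∈ codedClosed k}}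
  let M₂ : Set T := {k | ∀ a b b', (a, b) ∈ codedClosed k → (a, b') ∈ codedClosed k → b = b'}
  let M₃ (w : Set (List Bool)) : Set T :=
    {k | SqStarDim r Γ (n + 1) {a | ∃ b, (a, b) ∈ codedClosed k ∧ b ∈ cylSet w}}
  have hG : IsClosed {p : T × E | p.2 ∈ codedClosed p.1} := isClosed_codedClosed_graph
  have hM₁ : MeasurableSet M₁ := by
    have h : IsClosed {p : (T × (Fin (n + 1) → Cantor)) × Cantor |
        (p.1.2, p.2) ∈ codedClosed p.1.1} :=
      hG.preimage (f := fun p : (T × (Fin (n + 1) → Cantor)) × Cantor =>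
        (p.1.1, (p.1.2, p.2))) (by fun_prop)
    exact (isClosed_setOf_sqTG r Θ Γ n h.exists_mem).measurableSet
  have hM₂ : MeasurableSet M₂ := by
    have h (i : ℕ) : IsClosed {p : T × ((Fin (n + 1) → Cantor) × Cantor × Cantor) |
        (p.2.1, p.2.2.1) ∈ codedClosed p.1 ∧ (p.2.1, p.2.2.2) ∈ codedClosed p.1 ∧
          p.2.2.1 i ≠ p.2.2.2 i} := by
      refine (hG.preimage (f := fun p : T × ((Fin (n + 1) → Cantor) × Cantor × Cantor) =>
        (p.1, (p.2.1, p.2.2.1))) (by fun_prop)).inter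
        ((hG.preimage (f := fun p : T × ((Fin (n + 1) → Cantor) × Cantor × Cantor) =>
        (p.1, (p.2.1, p.2.2.2))) (by fun_prop)).inter ?_)
      exact (isClosed_discrete {q : Bool × Bool | q.1 ≠ q.2}).preimage
        (f := fun p : T × ((Fin (n + 1) → Cantor) × Cantor × Cantor) =>
          (p.2.2.1 i, p.2.2.2 i)) (by fun_prop)
    have hM : M₂ = (⋃ i, {k | ∃ x : (Fin (n + 1) → Cantor) × Cantor × Cantor,
        (x.1, x.2.1) ∈ codedClosed k ∧ (x.1, x.2.2) ∈ codedClosed k ∧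
          x.2.1 i ≠ x.2.2 i})ᶜ := by
      ext k
      rw [mem_compl_iff, mem_iUnion]
      constructor
      · rintro H ⟨i, ⟨a, b, b'⟩, h₁, h₂, hne⟩
        exact hne (congrFun (H a b b' h₁ h₂) i)
      · intro H a b b' h₁ h₂
        by_contra hne
        obtain ⟨i, hi⟩ := Function.ne_iff.1 hne
        exact H ⟨i, ⟨a, b, b'⟩, h₁, h₂, hi⟩
    rw [hM]
    exact (MeasurableSet.iUnion fun i => (h i).exists_mem.measurableSet).compl
  have hM₃ (w) (hw : w ∈ 𝒳) : MeasurableSet (M₃ w) := by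
    have h : IsClosed {p : (T × (Fin (n + 1) → Cantor)) × Cantor |
        (p.1.2, p.2) ∈ codedClosed p.1.1 ∧ p.2 ∈ cylSet w} :=
      (hG.preimage (f := fun p : (T × (Fin (n + 1) → Cantor)) × Cantor =>
        (p.1.1, (p.1.2, p.2))) (by fun_prop)).inter
        ((isClosed_cylSet (h𝒳 w hw)).preimage continuous_snd)
    exact measurableSet_setOf_sqStarDim r Γ n h.exists_mem
  have hM : MeasurableSet ((M₁ ∩ M₂) ×ˢ univ ∩
      ⋂ w ∈ 𝒳, (M₃ w ×ˢ (cylSet (B w))ᶜ)ᶜ : Set (T × Cantor)) :=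
    ((hM₁.inter hM₂).prod .univ).inter <| .biInter hcount fun w hw =>
      ((hM₃ w hw).prod (isOpen_cylSet _).measurableSet.compl).compl
  convert hM.analyticSet.image_of_continuous continuous_snd using 1
  ext z
  rw [mem_ofPred_eq, notMem_rhoStar_iff r Θ Γ _ hn]
  simp only [mem_image, mem_inter_iff, mem_prod, mem_univ, and_true, mem_iInter, mem_compl_iff,
    Prod.exists, exists_eq_right, angbr, mem_ofPred_eq, M₁, M₂, M₃]
  constructor
  · rintro ⟨K, hK, h₁, h₂, h₃⟩
    obtain ⟨k, rfl⟩ := exists_codedClosed_eq hK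
    exact ⟨k, ⟨h₁, h₂⟩, fun w hw h => h₃ w ⟨hw, h.2⟩ h.1⟩
  · rintro ⟨k, ⟨h₁, h₂⟩, h₃⟩
    exact ⟨_, isClosed_codedClosed k, h₁, h₂, fun w hw h => h₃ w hw.1 ⟨h, hw.2⟩⟩

theorem statement11 (r : ℝ) (hr0 : 0 < r) (hr1 : r < 1)
    (Θ Γ : ℕ → ℝ) (hΘpos : ∀ i, 0 < Θ i) (hΓpos : ∀ i, 0 < Γ i)
    (hΘanti : StrictAnti Θ) (hΘlim : Filter.Tendsto Θ Filter.atTop (nhds 0))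
    (hΘΓ : ∀ j, Θ j + Γ j < 1) (hΘΓsucc : ∀ j, Θ j + Γ (j + 1) < 1)
    (hΓdense : ∀ x ∈ Set.Ioo (0 : ℝ) 1, x ∈ closure (Set.range Γ))
    (𝒳 : Set (Set (List Bool))) (h𝒳 : ∀ a ∈ 𝒳, a.Finite)
    (B : Set (List Bool) → Set (List Bool)) (j : ℕ) :
    MeasureTheory.AnalyticSet {z : Cantor | rho r Θ Γ (angbr z B 𝒳) < (j : ℕ∞)} := by
  rcases eq_or_ne j 0 with rfl | hj
  · simpa using analyticSet_empty
  have hset : {z : Cantor | rho r Θ Γ (angbr z B 𝒳) < (j : ℕ∞)} =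
      ⋂ d : Ici j, {z | (d : ℕ) ∉ rhoStar r Θ Γ (angbr z B 𝒳)} := by
    ext z
    simp [rho_lt_iff r Θ Γ _ hj]
  rw [hset]
  exact AnalyticSet.iInter fun d => analyticSet_setOf_notMem_rhoStar r Θ Γ h𝒳 B d
end
end

section
/- Let {δ_n}_{n∈ℕ} be a sequence of positive reals, let {A_n}_{n∈ℕ} be a sequence of subsets of Q with Σ_{a∈A_n} 2^{−|a|r} ≤ 1 for each n, and let K ⊆ ℕ be infinite. Then there are strictly increasing sequences of integers {k_n}_{n∈ℕ} ⊆ K and {m_n}_{n∈ℕ} such that, setting D_n = A_{m_n} ∩ Q[<k_n], for every n: (i) D_n = D_i ∩ Q[<k_n] for all i ≥ n, and (ii) λ(⋃_{i=n}^∞ [A_{m_i} ∖ D_n]) < δ_n. -/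
open MeasureTheory Filter Set Topology
open scoped ENNReal

noncomputable section

theorem measurable_binaryDigits :
    Measurable (fun x : ℝ => fun n : ℕ => decide (⌊x * 2 ^ (n + 1)⌋ % 2 = 1)) := by
  refine measurable_pi_lambda _ fun n => ?_
  have h : Measurable fun z : ℤ => decide (z % 2 = 1) := measurable_from_top
  exact h.comp (Int.measurable_floor.comp (measurable_id.mul_const _))

theorem measurableSet_cyl (a : List Bool) : MeasurableSet (cyl a) := by
  have : cyl a = ⋂ i : Fin a.length, (fun x : Cantor => x i) ⁻¹' {a.get i} := by
    ext x
    simp [cyl]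
  rw [this]
  exact MeasurableSet.iInter fun i => measurable_pi_apply _ (measurableSet_singleton _)

/-- A point of `[0,1)` has its dyadic approximation of order `N` determined by its first `N`
binary digits. -/
theorem floor_mul_two_pow_eq {x y : ℝ} (hx : x ∈ Set.Ico (0 : ℝ) 1) (hy : y ∈ Set.Ico (0 : ℝ) 1)
    (N : ℕ) (h : ∀ n < N, (⌊x * 2 ^ (n + 1)⌋ % 2 = 1 ↔ ⌊y * 2 ^ (n + 1)⌋ % 2 = 1)) :
    ⌊x * 2 ^ N⌋ = ⌊y * 2 ^ N⌋ := by
  induction N with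
  | zero =>
    rw [pow_zero, mul_one, mul_one, Int.floor_eq_zero_iff.2 hx, Int.floor_eq_zero_iff.2 hy]
  | succ N ih =>
    have key : ∀ z : ℝ, 2 * ⌊z * 2 ^ N⌋ ≤ ⌊z * 2 ^ (N + 1)⌋ ∧
        ⌊z * 2 ^ (N + 1)⌋ < 2 * ⌊z * 2 ^ N⌋ + 2 := by
      intro z
      have h1 := Int.floor_le (z * 2 ^ N)
      have h2 := Int.lt_floor_add_one (z * 2 ^ N)
      constructor
      · rw [Int.le_floor]
        push_cast
        rw [pow_succ]
        linarith
      · rw [Int.floor_lt]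
        push_cast
        rw [pow_succ]
        linarith
    have hN := ih fun n hn => h n (hn.trans N.lt_succ_self)
    have := h N N.lt_succ_self
    have := key x
    have := key y
    omega

theorem cantorMeasure_cyl_le (a : List Bool) :
    cantorMeasure (cyl a) ≤ (2 : ℝ≥0∞)⁻¹ ^ a.length := by
  rw [cantorMeasure, Measure.map_apply measurable_binaryDigits (measurableSet_cyl a),
    Measure.restrict_apply (measurable_binaryDigits (measurableSet_cyl a))]
  rcases Set.eq_empty_or_nonempty (((fun x : ℝ => fun n : ℕ =>
    decide (⌊x * 2 ^ (n + 1)⌋ % 2 = 1)) ⁻¹' cyl a) ∩ Set.Ico (0 : ℝ) 1) with h | ⟨x, hxa, hx⟩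
  · rw [h, measure_empty]
    exact zero_le
  · set N := a.length with hN
    set c := ⌊x * 2 ^ N⌋ with hc
    have hsub : (((fun x : ℝ => fun n : ℕ =>
        decide (⌊x * 2 ^ (n + 1)⌋ % 2 = 1)) ⁻¹' cyl a) ∩ Set.Ico (0 : ℝ) 1) ⊆
        Set.Ico ((c : ℝ) / 2 ^ N) ((c + 1) / 2 ^ N) := by
      rintro y ⟨hya, hy⟩
      have hfl : c = ⌊y * 2 ^ N⌋ := floor_mul_two_pow_eq hx hy N fun n hn => by
        have h1 := hxa ⟨n, hn⟩
        have h2 := hya ⟨n, hn⟩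
        exact decide_eq_decide.1 (h1.trans h2.symm)
      have hp : (0 : ℝ) < 2 ^ N := by positivity
      rw [Set.mem_Ico, div_le_iff₀ hp, lt_div_iff₀ hp, hfl]
      exact ⟨Int.floor_le _, Int.lt_floor_add_one _⟩
    refine (measure_mono hsub).trans ?_
    rw [Real.volume_Ico, ← sub_div, add_sub_cancel_left, one_div, ← inv_pow,
      ENNReal.ofReal_pow (by norm_num), ENNReal.ofReal_inv_of_pos (by norm_num)]
    simp

theorem wt_mul_rpow (r : ℝ) (a : List Bool) :
    wt r a * ((2 : ℝ≥0∞) ^ (-(1 - r))) ^ a.length = (2 : ℝ≥0∞)⁻¹ ^ a.length := by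
  rw [wt, ← ENNReal.rpow_mul_natCast, ← ENNReal.rpow_add _ _ (by norm_num) (by norm_num),
    ← ENNReal.rpow_neg_one, ← ENNReal.rpow_mul_natCast]
  congr 1
  ring

theorem two_rpow_neg_lt_one {r : ℝ} (hr : r < 1) : (2 : ℝ≥0∞) ^ (-(1 - r)) < 1 :=
  ENNReal.rpow_lt_one_of_one_lt_of_neg (by norm_num) (by linarith)

/-- The part of a set of weight at most `1` lying above level `k` covers a set of small measure. -/
theorem cantorMeasure_cylSet_le {r : ℝ} (hr : r < 1) {A : Set (List Bool)} (hA : wtSum r A ≤ 1)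
    (k : ℕ) :
    cantorMeasure (cylSet {a ∈ A | k ≤ a.length}) ≤ ((2 : ℝ≥0∞) ^ (-(1 - r))) ^ k := by
  set q : ℝ≥0∞ := (2 : ℝ≥0∞) ^ (-(1 - r)) with hq
  set B : Set (List Bool) := {a ∈ A | k ≤ a.length} with hB
  calc cantorMeasure (cylSet B) ≤ ∑' a : B, cantorMeasure (cyl a) :=
        measure_biUnion_le _ (Set.to_countable _) _
    _ ≤ ∑' a : B, wt r a * q ^ k := by
        refine ENNReal.tsum_le_tsum fun a => (cantorMeasure_cyl_le _).trans ?_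
        rw [← wt_mul_rpow r]
        gcongr _ * ?_
        exact pow_le_pow_right_of_le_one' (two_rpow_neg_lt_one hr).le a.2.2
    _ = wtSum r B * q ^ k := by rw [ENNReal.tsum_mul_right, wtSum]
    _ ≤ 1 * q ^ k := by
        gcongr
        exact (ENNReal.tsum_mono_subtype _ (Set.sep_subset _ _)).trans hA
    _ = q ^ k := one_mul _

/-- The limit of a sequence of sets along a filter. -/
def limitSet (U : Filter ℕ) (A : ℕ → Set (List Bool)) : Set (List Bool) :=
  {a | ∀ᶠ n in U, a ∈ A n}

theorem wtSum_limitSet_le {r : ℝ} {U : Filter ℕ} [U.NeBot] {A : ℕ → Set (List Bool)}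
    (hA : ∀ n, wtSum r (A n) ≤ 1) : wtSum r (limitSet U A) ≤ 1 := by
  rw [wtSum, ENNReal.tsum_eq_iSup_sum]
  refine iSup_le fun s => ?_
  have hs : ∀ᶠ n in U, ∀ a ∈ s, (a : List Bool) ∈ A n :=
    (Filter.eventually_all_finset s).2 fun a _ => a.2
  obtain ⟨n, hn⟩ := hs.exists
  refine le_trans ?_ (hA n)
  rw [wtSum, tsum_subtype (A n) (wt r)]
  calc ∑ a ∈ s, wt r (a : List Bool)
      = ∑ a ∈ s.map (Function.Embedding.subtype _), (A n).indicator (wt r) a := by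
        rw [Finset.sum_map]
        exact Finset.sum_congr rfl fun a ha => (Set.indicator_of_mem (hn a ha) _).symm
    _ ≤ _ := ENNReal.sum_le_tsum _

theorem eventually_agree_limitSet (U : Ultrafilter ℕ) (A : ℕ → Set (List Bool)) (k : ℕ) :
    ∀ᶠ n in (U : Filter ℕ), ∀ a : List Bool, a.length < k → (a ∈ A n ↔ a ∈ limitSet U A) := by
  have hfin : {a : List Bool | a.length < k}.Finite := List.finite_length_lt Bool k
  refine (Filter.eventually_all_finite hfin).2 fun a _ => ?_
  by_cases h : a ∈ limitSet U A
  · exact Filter.Eventually.mono h fun n hn => ⟨fun _ => h, fun _ => hn⟩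
  · have h' : ∀ᶠ n in (U : Filter ℕ), a ∉ A n := Ultrafilter.eventually_not.2 h
    exact h'.mono fun n hn => ⟨fun h1 => absurd h1 hn, fun h1 => absurd h1 h⟩

theorem statement16 (r : ℝ) (hr0 : 0 < r) (hr1 : r < 1)
    (δ : ℕ → ℝ) (hδ : ∀ n, 0 < δ n)
    (A : ℕ → Set (List Bool)) (hA : ∀ n, wtSum r (A n) ≤ 1)
    (K : Set ℕ) (hK : K.Infinite) :
    ∃ k m : ℕ → ℕ, StrictMono k ∧ StrictMono m ∧ (∀ n, k n ∈ K) ∧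
      ∀ n : ℕ,
        (∀ i, n ≤ i →
          A (m n) ∩ {t : List Bool | t.length < k n} =
            (A (m i) ∩ {t : List Bool | t.length < k i}) ∩
              {t : List Bool | t.length < k n}) ∧
        cantorMeasure (⋃ i, ⋃ (_ : n ≤ i),
            cylSet (A (m i) \ (A (m n) ∩ {t : List Bool | t.length < k n}))) <
          ENNReal.ofReal (δ n) := by
  set q : ℝ≥0∞ := (2 : ℝ≥0∞) ^ (-(1 - r)) with hq
  have hq1 : q < 1 := two_rpow_neg_lt_one hr1
  have hC : 1 + (1 - q)⁻¹ ≠ ∞ := by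
    simpa [ENNReal.add_eq_top, tsub_eq_zero_iff_le] using hq1
  obtain ⟨k, hk, hkP⟩ : ∃ k : ℕ → ℕ, StrictMono k ∧
      ∀ n, k n ∈ K ∧ q ^ k n * (1 + (1 - q)⁻¹) < ENNReal.ofReal (δ n) := by
    refine Filter.extraction_forall_of_frequently
      (P := fun n j => j ∈ K ∧ q ^ j * (1 + (1 - q)⁻¹) < ENNReal.ofReal (δ n)) fun n => ?_
    have hlim : Tendsto (fun j : ℕ => q ^ j * (1 + (1 - q)⁻¹)) atTop (𝓝 0) := by
      simpa using ENNReal.Tendsto.mul_const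
        (ENNReal.tendsto_pow_atTop_nhds_zero_of_lt_one hq1) (Or.inr hC)
    exact (Nat.frequently_atTop_iff_infinite.2 hK).and_eventually
      (hlim.eventually_lt_const (ENNReal.ofReal_pos.2 (hδ n)))
  set U : Ultrafilter ℕ := hyperfilter ℕ
  set B := limitSet U A
  have hB : wtSum r B ≤ 1 := wtSum_limitSet_le hA
  obtain ⟨m, hm, hmP⟩ : ∃ m : ℕ → ℕ, StrictMono m ∧
      ∀ n, ∀ a : List Bool, a.length < k n → (a ∈ A (m n) ↔ a ∈ B) := by
    refine Filter.extraction_forall_of_frequently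
      (P := fun n j => ∀ a : List Bool, a.length < k n → (a ∈ A j ↔ a ∈ B)) fun n => ?_
    exact (eventually_agree_limitSet U A (k n)).frequently.filter_mono Nat.hyperfilter_le_atTop
  refine ⟨k, m, hk, hm, fun n => (hkP n).1, fun n => ⟨fun i hi => ?_, ?_⟩⟩
  · ext a
    simp only [Set.mem_inter_iff, Set.mem_ofPred_eq]
    constructor
    · rintro ⟨h1, h2⟩
      have h3 := h2.trans_le (hk.monotone hi)
      exact ⟨⟨(hmP i a h3).2 ((hmP n a h2).1 h1), h3⟩, h2⟩
    · rintro ⟨⟨h1, h3⟩, h2⟩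
      exact ⟨(hmP n a h2).2 ((hmP i a h3).1 h1), h2⟩
  · have hsub : (⋃ i, ⋃ (_ : n ≤ i),
        cylSet (A (m i) \ (A (m n) ∩ {t : List Bool | t.length < k n}))) ⊆
        cylSet {a ∈ B | k n ≤ a.length} ∪
          ⋃ j, cylSet {a ∈ A (m (n + j)) | k (n + j) ≤ a.length} := by
      refine Set.iUnion₂_subset fun i hi => Set.iUnion₂_subset fun a ha => ?_
      by_cases hai : a.length < k i
      · have haB : a ∈ B := (hmP i a hai).1 ha.1
        have hlen : k n ≤ a.length := by
          by_contra! hlt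
          exact ha.2 ⟨(hmP n a hlt).2 haB, hlt⟩
        exact (Set.subset_biUnion_of_mem (u := cyl)
          (show a ∈ {a ∈ B | k n ≤ a.length} from ⟨haB, hlen⟩)).trans Set.subset_union_left
      · obtain ⟨j, rfl⟩ := Nat.exists_eq_add_of_le hi
        have h := Set.subset_biUnion_of_mem (u := cyl)
          (show a ∈ {a ∈ A (m (n + j)) | k (n + j) ≤ a.length} from ⟨ha.1, not_lt.1 hai⟩)
        exact (h.trans (Set.subset_iUnion (fun j =>
          cylSet {a ∈ A (m (n + j)) | k (n + j) ≤ a.length}) j)).trans Set.subset_union_right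
    refine lt_of_le_of_lt ?_ (hkP n).2
    calc _ ≤ _ := measure_mono hsub
      _ ≤ _ := measure_union_le _ _
      _ ≤ q ^ k n + ∑' j, q ^ k n * q ^ j := by
        refine add_le_add (cantorMeasure_cylSet_le hr1 hB _) ((measure_iUnion_le _).trans ?_)
        refine ENNReal.tsum_le_tsum fun j => (cantorMeasure_cylSet_le hr1 (hA _) _).trans ?_
        rw [← pow_add]
        refine pow_le_pow_right_of_le_one' hq1.le ?_
        rw [add_comm n j, add_comm (k n)]
        exact hk.add_le_nat j n
      _ = q ^ k n * (1 + (1 - q)⁻¹) := by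
        rw [ENNReal.tsum_mul_left, ENNReal.tsum_geometric, mul_add, mul_one]
end
end
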